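/- Let K be an algebraically closed field of characteristic 0 and let L ⊆ Sym^3 be the K-span of {s³, s²·t, t³}. Then for every Q = (α, β) ∈ K × K with (α, β) ≠ (0, 0): the value semigroup S(L, Q) is finitely generated if and only if α = 0 or β = 0 (i.e. Q = (1:0) or Q = (0:1)). (Example 4.9 of the paper.) -/

import Mathlib

open MvPolynomial Filter

noncomputable section

variable {K : Type} [Field K]

/-- The linear form `β·s − α·t` in `K[s,t]`, cutting out the point `Q = (α : β)` of `ℙ¹`. -/
def lform (α β : K) : MvPolynomial (Fin 2) K := C β * X 0 - C α * X 1

/-- The value semigroup `S(L, Q) = {(k, ord_Q f) : f ∈ L^k, f ≠ 0}` of the homogeneous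
valuation `ν_Q` on `R(L) = ⨁ₖ L^k`, where `ord_Q f` is the largest `e` such that
`(β·s − α·t)^e` divides `f`. -/
def curveValueSemigroup (L : Submodule K (MvPolynomial (Fin 2) K)) (α β : K) :
    AddSubmonoid (ℤ × ℤ) :=
  AddSubmonoid.closure
    {p | ∃ (k e : ℕ) (f : MvPolynomial (Fin 2) K), f ∈ L ^ k ∧ f ≠ 0 ∧
      (lform α β) ^ e ∣ f ∧ ¬ (lform α β) ^ (e + 1) ∣ f ∧ p = ((k : ℤ), (e : ℤ))}

/-! ### Monomial linear systems at the coordinate points -/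

theorem X_pow_dvd_iff_forall_mem_support {σ R : Type*} [CommRing R] {i : σ} {e : ℕ}
    {f : MvPolynomial σ R} : X i ^ e ∣ f ↔ ∀ m ∈ f.support, e ≤ m i := by
  rw [X_pow_eq_monomial, monomial_one_dvd_iff_modMonomial_eq_zero]
  constructor
  · intro h m hm
    by_contra hlt
    rw [mem_support_iff, ← coeff_modMonomial_of_not_le f
      (mt Finsupp.single_le_iff.mp hlt), h] at hm
    exact hm (coeff_zero m)
  · intro h
    ext m
    by_cases hm : Finsupp.single i e ≤ m
    · rw [coeff_modMonomial_of_le f hm, coeff_zero]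
    · rw [coeff_modMonomial_of_not_le f hm, coeff_zero]
      by_contra hne
      exact hm (Finsupp.single_le_iff.mpr (h m (mem_support_iff.mpr hne)))

open scoped Pointwise in
theorem curveValueSemigroup_restrictSupport {M : Set (Fin 2 →₀ ℕ)} {α β : K} {i : Fin 2}
    (hi : Associated (lform α β) (X i)) :
    curveValueSemigroup (restrictSupport K M) α β =
      AddSubmonoid.closure ((fun m => ((1 : ℤ), (m i : ℤ))) '' M) := by
  have hdvd (e : ℕ) (f : MvPolynomial (Fin 2) K) :
      lform α β ^ e ∣ f ↔ ∀ m ∈ f.support, e ≤ m i :=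
    (hi.pow_pow (n := e)).dvd_iff_dvd_left.trans X_pow_dvd_iff_forall_mem_support
  have hmem (k : ℕ) : ∀ m ∈ k • M, ((k : ℤ), (m i : ℤ)) ∈
      AddSubmonoid.closure ((fun m : Fin 2 →₀ ℕ => ((1 : ℤ), (m i : ℤ))) '' M) := by
    induction k with
    | zero =>
      intro m hm
      obtain rfl : m = 0 := by simpa using hm
      exact zero_mem _
    | succ k ih =>
      intro m hm
      rw [succ_nsmul] at hm
      obtain ⟨a, ha, b, hb, rfl⟩ := Set.mem_add.mp hm
      simpa using add_mem (ih a ha) (AddSubmonoid.subset_closure (Set.mem_image_of_mem _ hb))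
  apply le_antisymm
  · rw [curveValueSemigroup, AddSubmonoid.closure_le]
    rintro p ⟨k, e, f, hf, -, he, he', rfl⟩
    rw [hdvd] at he he'
    push Not at he'
    obtain ⟨m, hm, hlt⟩ := he'
    obtain rfl : e = m i := le_antisymm (he m hm) (Nat.lt_succ_iff.mp hlt)
    rw [← restrictSupport_nsmul] at hf
    exact hmem k m (mem_restrictSupport_iff K |>.mp hf hm)
  · rw [AddSubmonoid.closure_le]
    rintro _ ⟨m, hm, rfl⟩
    refine AddSubmonoid.subset_closure ⟨1, m i, monomial m 1, ?_, ?_, ?_, ?_, by simp⟩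
    · simpa using hm
    · simp
    · rw [hdvd]
      simp
    · rw [hdvd]
      simp

theorem curveValueSemigroup_restrictSupport_fg {M : Set (Fin 2 →₀ ℕ)} (hM : M.Finite)
    {α β : K} {i : Fin 2} (hi : Associated (lform α β) (X i)) :
    (curveValueSemigroup (restrictSupport K M) α β).FG := by
  rw [curveValueSemigroup_restrictSupport hi]
  exact (AddSubmonoid.fg_iff _).mpr ⟨_, rfl, hM.image _⟩

theorem lform_associated_X_zero {β : K} (hβ : β ≠ 0) : Associated (lform 0 β) (X 0) := by
  have h : IsUnit (C β : MvPolynomial (Fin 2) K) := hβ.isUnit.map C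
  simpa [lform] using (associated_isUnit_mul_left_iff h).mpr (Associated.refl (X 0))

theorem lform_associated_X_one {α : K} (hα : α ≠ 0) : Associated (lform α 0) (X 1) := by
  have h : IsUnit (C (-α) : MvPolynomial (Fin 2) K) := (neg_ne_zero.mpr hα).isUnit.map C
  simpa [lform] using (associated_isUnit_mul_left_iff h).mpr (Associated.refl (X 1))

/-! ### The linear system spanned by `s³`, `s²t`, `t³` -/

variable (K) in
/-- The linear system of binary cubics spanned by `s³`, `s²t` and `t³`. -/
def cuspidalSystem : Submodule K (MvPolynomial (Fin 2) K) :=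
  Submodule.span K {X 0 ^ 3, X 0 ^ 2 * X 1, X 1 ^ 3}

theorem cuspidalSystem_eq_restrictSupport :
    cuspidalSystem K = restrictSupport K {Finsupp.single 0 3,
      Finsupp.single 0 2 + Finsupp.single 1 1, Finsupp.single 1 3} := by
  rw [restrictSupport_eq_span, cuspidalSystem]
  simp [Set.image_insert_eq, monomial_add_single, ← X_pow_eq_monomial]

theorem isHomogeneous_of_mem_cuspidalSystem_pow {k : ℕ} {f : MvPolynomial (Fin 2) K}
    (hf : f ∈ cuspidalSystem K ^ k) : f.IsHomogeneous (3 * k) := by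
  have hle : cuspidalSystem K ≤ homogeneousSubmodule (Fin 2) K 3 := by
    rw [cuspidalSystem, Submodule.span_le]
    rintro _ (rfl | rfl | rfl)
    · exact isHomogeneous_X_pow 0 3
    · exact (isHomogeneous_X_pow 0 2).mul (isHomogeneous_X K 1)
    · exact isHomogeneous_X_pow 1 3
  induction k generalizing f with
  | zero =>
    obtain ⟨c, rfl⟩ := Submodule.mem_one.mp (pow_zero (cuspidalSystem K) ▸ hf)
    exact isHomogeneous_C _ c
  | succ k ih =>
    rw [pow_succ] at hf
    exact (Submodule.mul_le (P := homogeneousSubmodule (Fin 2) K (3 * (k + 1)))).mpr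
      (fun a ha b hb => (ih ha).mul (hle hb)) hf

variable (K) in
/-- The functional `f ↦ ∂f/∂s (0, 1)`; on forms of degree `d` it is the coefficient
of `s t ^ (d - 1)`. -/
def cuspFunctional : MvPolynomial (Fin 2) K →ₗ[K] K :=
  (aeval (R := K) ![(0 : K), 1]).toLinearMap ∘ₗ (pderiv 0).toLinearMap

theorem cuspFunctional_apply (f : MvPolynomial (Fin 2) K) :
    cuspFunctional K f = eval ![(0 : K), 1] (pderiv 0 f) := by
  simp [cuspFunctional]

theorem cuspFunctional_eq_zero_of_mem_pow {k : ℕ} {f : MvPolynomial (Fin 2) K}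
    (hf : f ∈ cuspidalSystem K ^ k) : cuspFunctional K f = 0 := by
  have hle : cuspidalSystem K ≤ (cuspFunctional K).ker := by
    rw [cuspidalSystem, Submodule.span_le]
    rintro _ (rfl | rfl | rfl) <;> simp [cuspFunctional_apply]
  induction k generalizing f with
  | zero =>
    obtain ⟨c, rfl⟩ := Submodule.mem_one.mp (pow_zero (cuspidalSystem K) ▸ hf)
    simp [cuspFunctional_apply]
  | succ k ih =>
    rw [pow_succ] at hf
    refine (Submodule.mul_le (P := (cuspFunctional K).ker)).mpr (fun a ha b hb => ?_) hf
    have ha' := ih ha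
    have hb' : cuspFunctional K b = 0 := hle hb
    rw [cuspFunctional_apply] at ha' hb'
    simp [cuspFunctional_apply, ha', hb']

theorem X_pow_mul_X_pow_mem_cuspidalSystem_pow {k a b : ℕ} (hab : a + b = 3 * k)
    (ha : a ≠ 1) : (X 0 ^ a * X 1 ^ b : MvPolynomial (Fin 2) K) ∈ cuspidalSystem K ^ k := by
  induction k generalizing a b with
  | zero =>
    obtain ⟨rfl, rfl⟩ : a = 0 ∧ b = 0 := by lia
    simpa using ⟨1, C_1⟩
  | succ k ih =>
    have hgen {g : MvPolynomial (Fin 2) K}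
        (hg : g ∈ ({X 0 ^ 3, X 0 ^ 2 * X 1, X 1 ^ 3} : Set (MvPolynomial (Fin 2) K)))
        {a' b' : ℕ} (hab' : a' + b' = 3 * k) (ha' : a' ≠ 1)
        (h : X 0 ^ a * X 1 ^ b = X 0 ^ a' * X 1 ^ b' * g) :
        X 0 ^ a * X 1 ^ b ∈ cuspidalSystem K ^ (k + 1) := by
      rw [h, pow_succ]
      exact Submodule.mul_mem_mul (ih hab' ha') (Submodule.subset_span hg)
    by_cases hb : 3 ≤ b
    · obtain ⟨c, rfl⟩ := Nat.exists_eq_add_of_le' hb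
      exact hgen (g := X 1 ^ 3) (by simp) (a' := a) (b' := c) (by lia) ha (by ring)
    · by_cases hb0 : b = 0
      · obtain ⟨c, rfl⟩ := Nat.exists_eq_add_of_le' (show 3 ≤ a by lia)
        exact hgen (g := X 0 ^ 3) (by simp) (a' := c) (b' := b) (by lia) (by lia) (by ring)
      · obtain ⟨c, rfl⟩ := Nat.exists_eq_add_of_le' (show 2 ≤ a by lia)
        obtain ⟨d, rfl⟩ := Nat.exists_eq_add_of_le' (show 1 ≤ b by lia)
        exact hgen (g := X 0 ^ 2 * X 1) (by simp) (a' := c) (b' := d) (by lia) (by lia)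
          (by ring)

theorem mem_cuspidalSystem_pow {k : ℕ} {f : MvPolynomial (Fin 2) K}
    (hf : f.IsHomogeneous (3 * k)) (hf' : cuspFunctional K f = 0) :
    f ∈ cuspidalSystem K ^ k := by
  have hsup : f ∈ cuspidalSystem K ^ k ⊔ Submodule.span K {X 0 * X 1 ^ (3 * k - 1)} := by
    rw [f.as_sum]
    refine Submodule.sum_mem _ fun m hm => ?_
    have hdeg : m 0 + m 1 = 3 * k := by
      have h := hf (mem_support_iff.mp hm)
      simpa [Finsupp.weight_apply, Finsupp.sum_fintype] using h
    have hmon : monomial m (coeff m f) = coeff m f • (X 0 ^ m 0 * X 1 ^ m 1) := by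
      rw [monomial_eq, Finsupp.prod_fintype _ _ (by simp), Fin.prod_univ_two, smul_eq_C_mul]
    rw [hmon]
    refine Submodule.smul_mem _ _ ?_
    by_cases hm0 : m 0 = 1
    · refine Submodule.mem_sup_right (Submodule.subset_span ?_)
      rw [hm0, pow_one, show m 1 = 3 * k - 1 by lia]
      rfl
    · exact Submodule.mem_sup_left (X_pow_mul_X_pow_mem_cuspidalSystem_pow hdeg hm0)
  obtain ⟨g, hg, h, hh, rfl⟩ := Submodule.mem_sup.mp hsup
  obtain ⟨c, rfl⟩ := Submodule.mem_span_singleton.mp hh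
  have hc : c = 0 := by
    rw [map_add, cuspFunctional_eq_zero_of_mem_pow hg] at hf'
    simpa [cuspFunctional_apply] using hf'
  simpa [hc] using hg

/-! ### Orders of vanishing away from the coordinate points -/

theorem lform_ne_zero {α β : K} (hα : α ≠ 0) : lform α β ≠ 0 := by
  intro h
  apply_fun eval ![(0 : K), 1] at h
  simp [lform, hα] at h

theorem lform_isHomogeneous (α β : K) : (lform α β).IsHomogeneous 1 :=
  (isHomogeneous_C_mul_X β 0).sub (isHomogeneous_C_mul_X α 1)

theorem cuspFunctional_lform_pow_mul (α β : K) (n : ℕ) (g : MvPolynomial (Fin 2) K) :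
    cuspFunctional K (lform α β ^ n * g) =
      (-α) ^ n * cuspFunctional K g + n * (-α) ^ (n - 1) * β * eval ![(0 : K), 1] g := by
  simp [cuspFunctional_apply, lform, Derivation.leibniz_pow]
  ring

theorem lt_of_lform_pow_dvd [CharZero K] {α β : K} (hα : α ≠ 0) (hβ : β ≠ 0) {k e : ℕ}
    (hk : k ≠ 0) {f : MvPolynomial (Fin 2) K} (hf : f ∈ cuspidalSystem K ^ k) (hf0 : f ≠ 0)
    (he : lform α β ^ e ∣ f) : e < 3 * k := by
  obtain ⟨g, rfl⟩ := he
  have hg0 : g ≠ 0 := right_ne_zero_of_mul hf0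
  have hdeg := (isHomogeneous_of_mem_cuspidalSystem_pow hf).totalDegree hf0
  have hpow := pow_ne_zero e (lform_ne_zero (β := β) hα)
  rw [totalDegree_mul_of_isDomain hpow hg0,
    ((lform_isHomogeneous α β).pow e).totalDegree hpow] at hdeg
  by_contra hle
  obtain ⟨he, hg⟩ : e = 3 * k ∧ g.totalDegree = 0 := by lia
  rw [totalDegree_eq_zero_iff_eq_C] at hg
  have hzero := cuspFunctional_eq_zero_of_mem_pow hf
  rw [hg, cuspFunctional_lform_pow_mul] at hzero
  have hcoeff : coeff 0 g ≠ 0 := fun h => hg0 (by rw [hg, h, C_0])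
  simp [cuspFunctional_apply, he, hk, hα, hβ, hcoeff] at hzero

theorem three_mul_sub_one_mem_curveValueSemigroup [CharZero K] {α β : K} (hα : α ≠ 0)
    (hβ : β ≠ 0) (n : ℕ) :
    (((n + 1 : ℕ) : ℤ), ((3 * n + 2 : ℕ) : ℤ)) ∈
      curveValueSemigroup (cuspidalSystem K) α β := by
  set g : MvPolynomial (Fin 2) K := C ((3 * n + 2) * β) * X 0 + C α * X 1 with hg
  have hg0 : g ≠ 0 := by
    intro h
    apply_fun eval ![(0 : K), 1] at h
    simp [hg, hα] at h
  have hf0 : lform α β ^ (3 * n + 2) * g ≠ 0 :=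
    mul_ne_zero (pow_ne_zero _ (lform_ne_zero hα)) hg0
  have hf : lform α β ^ (3 * n + 2) * g ∈ cuspidalSystem K ^ (n + 1) := by
    apply mem_cuspidalSystem_pow
    · convert ((lform_isHomogeneous α β).pow (3 * n + 2)).mul
        ((isHomogeneous_C_mul_X ((3 * n + 2) * β) 0).add (isHomogeneous_C_mul_X α 1)) using 1
      ring
    · rw [cuspFunctional_lform_pow_mul]
      simp [cuspFunctional_apply, hg]
      ring
  refine AddSubmonoid.subset_closure
    ⟨n + 1, 3 * n + 2, _, hf, hf0, dvd_mul_right _ _, fun hdvd => ?_, rfl⟩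
  have := lt_of_lform_pow_dvd hα hβ n.succ_ne_zero hf hf0 hdvd
  lia

theorem eq_zero_or_lt_of_mem_curveValueSemigroup [CharZero K] {α β : K} (hα : α ≠ 0)
    (hβ : β ≠ 0) {p : ℤ × ℤ} (hp : p ∈ curveValueSemigroup (cuspidalSystem K) α β) :
    p = 0 ∨ p.2 < 3 * p.1 := by
  induction hp using AddSubmonoid.closure_induction with
  | zero => exact .inl rfl
  | add x y _ _ hx hy =>
    rcases hx with rfl | hx
    · simpa using hy
    · rcases hy with rfl | hy
      · simpa using Or.inr hx
      · exact .inr (by simp only [Prod.fst_add, Prod.snd_add]; lia)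
  | mem x hx =>
    obtain ⟨k, e, f, hf, hf0, he, -, rfl⟩ := hx
    rcases eq_or_ne k 0 with rfl | hk
    · left
      have hdeg := totalDegree_le_of_dvd_of_isDomain he hf0
      rw [((lform_isHomogeneous α β).pow e).totalDegree
        (pow_ne_zero e (lform_ne_zero hα)),
        (isHomogeneous_of_mem_cuspidalSystem_pow hf).totalDegree hf0] at hdeg
      obtain rfl : e = 0 := by lia
      rfl
    · right
      have := lt_of_lform_pow_dvd hα hβ hk hf hf0 he
      simp only
      lia

/-- An element of value `1` under an additive functional that is positive on the nonzero
generators of a monoid is one of the generators. -/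
theorem mem_of_mem_closure_of_map_eq_one {M : Type*} [AddMonoid M] {G : Set M} (φ : M →+ ℤ)
    (hG : ∀ x ∈ G, x = 0 ∨ 0 < φ x) {x : M} (hx : x ∈ AddSubmonoid.closure G)
    (hφ : φ x = 1) : x ∈ G := by
  have key : x = 0 ∨ 1 < φ x ∨ (x ∈ G ∧ 0 < φ x) := by
    clear hφ
    induction hx using AddSubmonoid.closure_induction with
    | zero => exact .inl rfl
    | mem x hx => exact (hG x hx).imp_right fun h => .inr ⟨hx, h⟩
    | add x y _ _ hx hy =>
      rcases hx with rfl | hx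
      · simpa using hy
      · rcases hy with rfl | hy
        · simpa using Or.inr hx
        · refine .inr (.inl ?_)
          rw [map_add]
          lia
  rcases key with rfl | h | h
  · simp at hφ
  · lia
  · exact h.1

theorem curveValueSemigroup_cuspidalSystem_not_fg [CharZero K] {α β : K} (hα : α ≠ 0)
    (hβ : β ≠ 0) : ¬ (curveValueSemigroup (cuspidalSystem K) α β).FG := by
  rw [AddSubmonoid.fg_iff]
  rintro ⟨G, hG, hfin⟩
  refine Set.infinite_of_injective_forall_mem
    (f := fun n : ℕ => (((n + 1 : ℕ) : ℤ), ((3 * n + 2 : ℕ) : ℤ))) ?_ (fun n => ?_) hfin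
  · intro m n h
    simpa using congrArg Prod.fst h
  · refine mem_of_mem_closure_of_map_eq_one
      (3 • AddMonoidHom.fst ℤ ℤ - AddMonoidHom.snd ℤ ℤ) (fun x hx => ?_)
      (hG ▸ three_mul_sub_one_mem_curveValueSemigroup hα hβ n) ?_
    · refine (eq_zero_or_lt_of_mem_curveValueSemigroup hα hβ
        (hG ▸ AddSubmonoid.subset_closure hx)).imp_right fun h => ?_
      simpa using h
    · simp
      ring

/-- **Example 4.9.** Let `K` be an algebraically closed field of characteristic `0` and
`L ⊆ Sym³` the span of `{s³, s²·t, t³}`. Then for a point `Q = (α : β)` of `ℙ¹`, the value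
semigroup `S(L, Q)` is finitely generated iff `α = 0` or `β = 0`. -/
theorem example49_khovanskiiFinite_iff [IsAlgClosed K] [CharZero K] :
    ∀ α β : K, (α, β) ≠ ((0 : K), (0 : K)) →
      ((curveValueSemigroup
          (Submodule.span K
            ({X 0 ^ 3, X 0 ^ 2 * X 1, X 1 ^ 3} : Set (MvPolynomial (Fin 2) K)))
          α β).FG ↔ α = 0 ∨ β = 0) := by
  intro α β hαβ
  change (curveValueSemigroup (cuspidalSystem K) α β).FG ↔ α = 0 ∨ β = 0
  constructor
  · intro hfg
    by_contra! hne
    exact curveValueSemigroup_cuspidalSystem_not_fg hne.1 hne.2 hfg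
  · rw [cuspidalSystem_eq_restrictSupport]
    rintro (rfl | rfl)
    · exact curveValueSemigroup_restrictSupport_fg (Set.toFinite _)
        (lform_associated_X_zero fun h => hαβ (by rw [h]))
    · exact curveValueSemigroup_restrictSupport_fg (Set.toFinite _)
        (lform_associated_X_one fun h => hαβ (by rw [h]))

end
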